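/- arXiv:2310.03868 — 6 statements merged into one kernel-verified Lean document; each statement's English description precedes it below -/
import Mathlib

section
/- Every finitely generated commutative (not necessarily unital) ring of prime characteristic p without zero divisors in which any two transcendental elements are integrally dependent is finitely separable. -/
/-- `nupow a n` represents the power `a ^ (n + 1)` in a (possibly non-unital) multiplicative
structure. -/
def nupow {K : Type*} [Mul K] (a : K) : ℕ → K
  | 0 => a
  | n + 1 => nupow a n * a

/-- Evaluation at `a ∈ K` of a one-variable polynomial over `ZMod p` with zero constant term;
coefficients act through their natural-number representatives (`ZMod.val`), which is the
natural action on a ring of characteristic `p`. -/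
noncomputable def pEval {p : ℕ} {K : Type*} [NonUnitalNonAssocRing K]
    (f : Polynomial (ZMod p)) (a : K) : K :=
  ∑ i ∈ f.support, (f.coeff i).val • (if i = 0 then 0 else nupow a (i - 1))

/-- Evaluation of the monomial `x ^ m 0 * y ^ m 1` at `(a, b)` (zero if `m = 0`). -/
noncomputable def monEval {K : Type*} [Mul K] [Zero K] (a b : K) (m : Fin 2 →₀ ℕ) : K :=
  if m 0 = 0 then (if m 1 = 0 then 0 else nupow b (m 1 - 1))
  else (if m 1 = 0 then nupow a (m 0 - 1) else nupow a (m 0 - 1) * nupow b (m 1 - 1))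

/-- Evaluation at `(a, b) ∈ K × K` of a two-variable polynomial over `ZMod p` with zero
constant term. -/
noncomputable def mvEval {p : ℕ} {K : Type*} [NonUnitalNonAssocRing K]
    (a b : K) (f : MvPolynomial (Fin 2) (ZMod p)) : K :=
  ∑ m ∈ f.support, (MvPolynomial.coeff m f).val • monEval a b m

/-- An element `a` of a ring of characteristic `p` is integral (algebraic over `Z_p`) if it is a
root of some nonzero polynomial over `Z_p` with zero constant term. -/
noncomputable def IsAlgebraicElt (p : ℕ) {K : Type*} [NonUnitalNonAssocRing K] (a : K) : Prop :=
  ∃ f : Polynomial (ZMod p), f ≠ 0 ∧ f.coeff 0 = 0 ∧ pEval f a = 0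

/-- An element is transcendental if it is not a root of any nonzero polynomial over `Z_p`
with zero constant term. -/
noncomputable def IsTranscendentalElt (p : ℕ) {K : Type*} [NonUnitalNonAssocRing K]
    (a : K) : Prop :=
  ∀ f : Polynomial (ZMod p), f ≠ 0 → f.coeff 0 = 0 → pEval f a ≠ 0

/-- A two-variable polynomial over `Z_p` is monic in the variable `i` if, viewed as a polynomial
in the variable `i`, its leading coefficient is `1`. -/
def MonicInVar {p : ℕ} (f : MvPolynomial (Fin 2) (ZMod p)) (i : Fin 2) : Prop :=
  MvPolynomial.coeff (Finsupp.single i (f.degreeOf i)) f = 1 ∧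
    ∀ m ∈ f.support, m i = f.degreeOf i → m = Finsupp.single i (f.degreeOf i)

/-- Two elements `a, b` of a ring of prime characteristic `p` are integrally dependent if
`f (a, b) = 0` for some polynomial `f ∈ Z_p[x, y]` with zero constant term that is monic as a
polynomial in `x` and monic as a polynomial in `y`. -/
noncomputable def IntegrallyDependent (p : ℕ) {K : Type*} [NonUnitalNonAssocRing K]
    (a b : K) : Prop :=
  ∃ f : MvPolynomial (Fin 2) (ZMod p), MvPolynomial.constantCoeff f = 0 ∧
    MonicInVar f 0 ∧ MonicInVar f 1 ∧ mvEval a b f = 0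

/-- A (not necessarily unital) ring `K` is finitely separable if every element `a ∉ A`, where
`A` is a (not necessarily unital) subring, can be separated from `A` by a homomorphism to a
finite ring. -/
def FinitelySeparable (K : Type*) [NonUnitalNonAssocRing K] : Prop :=
  ∀ (a : K) (A : NonUnitalSubring K), a ∉ A →
    ∃ (F : Type) (_ : NonUnitalRing F) (_ : Finite F) (φ : K →ₙ+* F),
      φ a ∉ φ '' (A : Set K)

/-- The `k`-torsion ideal `I_k = {a ∈ K : k • a = 0}` of `K`, as an additive subgroup. -/
def torsionAddSubgroup (K : Type*) [NonUnitalNonAssocRing K] (k : ℕ) : AddSubgroup K where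
  carrier := {a | k • a = 0}
  add_mem' := by
    intro a b ha hb
    simp only [Set.mem_setOf_eq, smul_add] at *
    rw [ha, hb, add_zero]
  zero_mem' := by simp
  neg_mem' := by
    intro a ha
    simp only [Set.mem_setOf_eq, smul_neg] at *
    rw [ha, neg_zero]

/-- The `k`-torsion ideal `I_k = {a ∈ K : k • a = 0}` of a commutative ring `K`, as a
non-unital subring (it is in fact an ideal). -/
def torsionSubring (K : Type*) [NonUnitalCommRing K] (k : ℕ) : NonUnitalSubring K where
  carrier := {a | k • a = 0}
  add_mem' := by
    intro a b ha hb
    simp only [Set.mem_setOf_eq, smul_add] at *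
    rw [ha, hb, add_zero]
  zero_mem' := by simp
  neg_mem' := by
    intro a ha
    simp only [Set.mem_setOf_eq, smul_neg] at *
    rw [ha, neg_zero]
  mul_mem' := by
    intro a b ha hb
    simp only [Set.mem_setOf_eq] at *
    rw [← smul_mul_assoc, ha, zero_mul]

open Polynomial in
/-- A finitely generated algebra that is integral over a one-generated subalgebra becomes finite
modulo any ideal containing a nonzero polynomial in the generator. -/
theorem finite_quotient_of_aeval_mem {k D : Type*} [Field k] [Finite k] [CommRing D] [Algebra k D]
    [Algebra.FiniteType k D] {a : D}
    (h : (aeval a : k[X] →ₐ[k] D).toRingHom.IsIntegral) (I : Ideal D) {g : k[X]} (hg : g ≠ 0)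
    (hgI : aeval a g ∈ I) : Finite (D ⧸ I) := by
  let b : D ⧸ I := Ideal.Quotient.mk I a
  have hb : IsIntegral k b := by
    refine IsAlgebraic.isIntegral ⟨g, hg, ?_⟩
    change aeval (Ideal.Quotient.mkₐ k I a) g = 0
    rw [aeval_algHom_apply]
    exact Ideal.Quotient.eq_zero_iff_mem.mpr hgI
  let B := Algebra.adjoin k {b}
  have hB : Algebra.IsIntegral k B := Algebra.IsIntegral.adjoin (by simpa using hb)
  let b' : B := ⟨b, Algebra.subset_adjoin rfl⟩
  have hcomp : (algebraMap B (D ⧸ I)).comp (aeval b' : k[X] →ₐ[k] B).toRingHom =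
      (Ideal.Quotient.mk I).comp (aeval a : k[X] →ₐ[k] D).toRingHom := by
    have : (B.val).comp (aeval b' : k[X] →ₐ[k] B) =
        (Ideal.Quotient.mkₐ k I).comp (aeval a : k[X] →ₐ[k] D) := by
      ext; simp [b', b]
    exact congrArg AlgHom.toRingHom this
  have hintegral : (algebraMap B (D ⧸ I)).IsIntegral := by
    refine RingHom.IsIntegral.tower_top (aeval b' : k[X] →ₐ[k] B).toRingHom _ ?_
    rw [hcomp]
    exact h.trans _ _ (RingHom.isIntegral_of_surjective _ Ideal.Quotient.mk_surjective)
  have : Algebra.IsIntegral k (D ⧸ I) := ⟨fun x => isIntegral_trans x (hintegral x)⟩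
  have : Module.Finite k (D ⧸ I) := Algebra.IsIntegral.finite
  exact Module.finite_of_finite k

open Polynomial in
/-- A submodule stable under multiplication by `a` is closed in the topology of ideals of finite
index, if the ambient algebra is finitely generated and integral over `k[a]`. -/
theorem exists_finite_quotient_of_mul_mem {k D : Type*} [Field k] [Finite k] [CommRing D]
    [Algebra k D] [Algebra.FiniteType k D] {a : D}
    (h : (aeval a : k[X] →ₐ[k] D).toRingHom.IsIntegral) (A : Submodule k D)
    (hA : ∀ x ∈ A, a * x ∈ A) {c : D} (hc : c ∉ A) :
    ∃ I : Ideal D, Finite (D ⧸ I) ∧ ∀ s ∈ A, c - s ∉ I := by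
  let _ : Algebra k[X] D := (aeval a : k[X] →ₐ[k] D).toRingHom.toAlgebra
  have hsmul (f : k[X]) (x : D) : f • x = aeval a f * x := rfl
  have hfin : Module.Finite k[X] D := by
    refine RingHom.finite_iff_isIntegral_and_finiteType.mpr ⟨h, ?_⟩
    refine RingHom.FiniteType.of_comp_finiteType (f := (C : k →+* k[X])) ?_
    have : (aeval a : k[X] →ₐ[k] D).toRingHom.comp C = algebraMap k D := by ext; simp
    rw [this]
    exact RingHom.finiteType_algebraMap.mpr inferInstance
  let N : Submodule k[X] D :=
    { A.toAddSubmonoid with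
      smul_mem' := by
        intro f x hx
        change f • x ∈ A
        induction f using Polynomial.induction_on' with
        | add f g hf hg => rw [add_smul]; exact A.add_mem hf hg
        | monomial n r =>
          rw [hsmul, aeval_monomial, mul_assoc, ← Algebra.smul_def]
          refine A.smul_mem r ?_
          induction n with
          | zero => simpa using hx
          | succ n ih => rw [pow_succ', mul_assoc]; exact hA _ ih }
  have hNA (x : D) : x ∈ N ↔ x ∈ A := Iff.rfl
  let J : Ideal k[X] := LinearMap.ker (LinearMap.toSpanSingleton k[X] (D ⧸ N) (N.mkQ c))
  have hJ : J ≠ ⊤ := by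
    intro hJ
    have h1 : (1 : k[X]) ∈ J := hJ ▸ Submodule.mem_top
    have : N.mkQ c = 0 := by simpa [J] using h1
    exact hc ((Submodule.Quotient.mk_eq_zero N).mp this)
  obtain ⟨m, hm, hJm⟩ := Ideal.exists_le_maximal J hJ
  have hnot : N.mkQ c ∉ (⨅ i : ℕ, m ^ i • ⊤ : Submodule k[X] (D ⧸ N)) := by
    rw [Ideal.mem_iInf_smul_pow_eq_bot_iff]
    rintro ⟨r, hr⟩
    have h1 : 1 - (r : k[X]) ∈ J := by
      rw [LinearMap.mem_ker, LinearMap.toSpanSingleton_apply, sub_smul, hr, one_smul, sub_self]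
    exact hm.ne_top ((Ideal.eq_top_iff_one m).mpr (by simpa using m.add_mem (hJm h1) r.2))
  simp only [Submodule.mem_iInf, not_forall] at hnot
  obtain ⟨n, hn⟩ := hnot
  obtain ⟨g, hgm, hg⟩ := Submodule.exists_mem_ne_zero_of_ne_bot
    (Ring.ne_bot_of_isMaximal_of_not_isField hm (Polynomial.not_isField k))
  refine ⟨(m ^ n).map (algebraMap k[X] D),
    finite_quotient_of_aeval_mem h _ (pow_ne_zero n hg)
      (Ideal.mem_map_of_mem (algebraMap k[X] D) (Ideal.pow_mem_pow hgm n)), fun s hs hcs => hn ?_⟩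
  have hcs' : c - s ∈ (m ^ n • ⊤ : Submodule k[X] D) := by
    rw [Ideal.smul_top_eq_map]; exact hcs
  have hs0 : N.mkQ s = 0 := (Submodule.Quotient.mk_eq_zero N).mpr hs
  have := Submodule.mem_map_of_mem (f := N.mkQ) hcs'
  rw [Submodule.map_smul'', map_sub, hs0, sub_zero] at this
  exact Submodule.smul_mono le_rfl le_top this

open Polynomial in
/-- A set of algebraic elements is closed in the topology of ideals of
finite index in a finitely generated domain integral over `k[a]`, `a` transcendental. -/
theorem exists_finite_quotient_of_isIntegral {k D : Type*} [Field k] [Finite k] [CommRing D]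
    [IsDomain D] [Algebra k D] [Algebra.FiniteType k D] {a : D}
    (h : (aeval a : k[X] →ₐ[k] D).toRingHom.IsIntegral) (ha : Transcendental k a)
    (A : Set D) (hA : ∀ x ∈ A, IsIntegral k x) {c : D} (hc : c ∉ A) :
    ∃ I : Ideal D, Finite (D ⧸ I) ∧ ∀ s ∈ A, c - s ∉ I := by
  have : IsNoetherianRing D := Algebra.FiniteType.isNoetherianRing k D
  have hau : ¬ IsUnit a := by
    intro hu
    have := h.isLocalHom (transcendental_iff_injective.mp ha)
    refine not_isUnit_X (R := k) (IsUnit.of_map (aeval a : k[X] →ₐ[k] D).toRingHom X ?_)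
    simpa using hu
  have htop : Ideal.span {a} ≠ ⊤ := by rwa [Ne, Ideal.span_singleton_eq_top]
  by_contra! hcon
  have hI (n : ℕ) : ∃ s ∈ A, c - s ∈ Ideal.span {a} ^ n := by
    refine hcon _ (finite_quotient_of_aeval_mem h _ (pow_ne_zero n X_ne_zero) ?_)
    rw [map_pow, aeval_X]
    exact Ideal.pow_mem_pow (Ideal.mem_span_singleton_self a) n
  obtain ⟨s, hs, hcs⟩ := hI 1
  suffices hs0 : c - s ∈ (⨅ n : ℕ, Ideal.span {a} ^ n : Ideal D) by
    rw [Ideal.iInf_pow_eq_bot_of_isDomain _ htop, Ideal.mem_bot, sub_eq_zero] at hs0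
    exact hc (hs0 ▸ hs)
  rw [Ideal.mem_iInf]
  intro n
  obtain ⟨t, ht, hct⟩ := hI (n + 1)
  have hts : t - s ∈ Ideal.span {a} := by
    have := sub_mem (by simpa using hcs) (Ideal.pow_le_self n.succ_ne_zero hct)
    simpa using this
  have : t - s = 0 := by
    by_contra hne
    exact htop (Ideal.eq_top_of_isUnit_mem _ hts (((hA t ht).sub (hA s hs)).isUnit hne))
  rw [← sub_eq_zero.mp this]
  exact Ideal.pow_le_pow_right n.le_succ hct

theorem map_nupow {K D : Type*} [NonUnitalRing K] [Ring D] (ι : K →ₙ+* D) (a : K) (n : ℕ) :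
    ι (nupow a n) = ι a ^ (n + 1) := by
  induction n with
  | zero => simp [nupow]
  | succ n ih => rw [nupow, map_mul, ih, ← pow_succ]

theorem ZMod.val_nsmul_eq_algebraMap_mul {p : ℕ} [NeZero p] {D : Type*} [Ring D]
    [Algebra (ZMod p) D] (z : ZMod p) (x : D) : z.val • x = algebraMap (ZMod p) D z * x := by
  rw [nsmul_eq_mul, ← map_natCast (algebraMap (ZMod p) D), ZMod.natCast_zmod_val]

theorem map_pEval {p : ℕ} [NeZero p] {K D : Type*} [NonUnitalRing K] [Ring D]
    [Algebra (ZMod p) D] (ι : K →ₙ+* D) (a : K) {f : Polynomial (ZMod p)} (hf : f.coeff 0 = 0) :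
    ι (pEval f a) = Polynomial.aeval (ι a) f := by
  rw [pEval, map_sum, Polynomial.aeval_def, Polynomial.eval₂_eq_sum, Polynomial.sum_def]
  refine Finset.sum_congr rfl fun i hi => ?_
  have hi0 : i ≠ 0 := by
    rintro rfl
    exact Polynomial.mem_support_iff.mp hi hf
  rw [map_nsmul, ZMod.val_nsmul_eq_algebraMap_mul, if_neg hi0, map_nupow,
    Nat.sub_add_cancel (Nat.pos_of_ne_zero hi0)]

theorem map_monEval {K D : Type*} [NonUnitalRing K] [Ring D] (ι : K →ₙ+* D) (a b : K)
    {m : Fin 2 →₀ ℕ} (hm : m ≠ 0) : ι (monEval a b m) = ι a ^ m 0 * ι b ^ m 1 := by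
  unfold monEval
  split_ifs with h0 h1 h1
  · refine absurd ?_ hm
    ext i
    fin_cases i <;> assumption
  all_goals simp only [map_mul, map_nupow, h0, h1, pow_zero, one_mul, mul_one]
  all_goals simp only [Nat.sub_add_cancel (Nat.pos_of_ne_zero ‹_›)]
  rw [Nat.sub_add_cancel (Nat.pos_of_ne_zero h0)]

theorem map_mvEval {p : ℕ} [NeZero p] {K D : Type*} [NonUnitalCommRing K] [CommRing D]
    [Algebra (ZMod p) D] (ι : K →ₙ+* D) (a b : K) {f : MvPolynomial (Fin 2) (ZMod p)}
    (hf : MvPolynomial.constantCoeff f = 0) :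
    ι (mvEval a b f) = MvPolynomial.aeval ![ι a, ι b] f := by
  rw [mvEval, map_sum, MvPolynomial.aeval_def, MvPolynomial.eval₂_eq']
  refine Finset.sum_congr rfl fun m hm => ?_
  have hm0 : m ≠ 0 := by
    rintro rfl
    exact MvPolynomial.mem_support_iff.mp hm hf
  rw [map_nsmul, ZMod.val_nsmul_eq_algebraMap_mul, map_monEval ι a b hm0]
  simp

theorem isAlgebraic_map_of_not_isTranscendentalElt {p : ℕ} [Fact p.Prime] {K D : Type*} [NonUnitalRing K]
    [Ring D] [Algebra (ZMod p) D] (ι : K →ₙ+* D) {a : K} (ha : ¬ IsTranscendentalElt p a) :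
    IsAlgebraic (ZMod p) (ι a) := by
  simp only [IsTranscendentalElt, not_forall, not_not] at ha
  obtain ⟨f, hf, hf0, hfa⟩ := ha
  exact ⟨f, hf, by rw [← map_pEval ι a hf0, hfa, map_zero]⟩

theorem IsTranscendentalElt.map {p : ℕ} [Fact p.Prime] {K D : Type*} [NonUnitalRing K]
    [Ring D] [Algebra (ZMod p) D] {ι : K →ₙ+* D} (hι : Function.Injective ι) {a : K}
    (ha : IsTranscendentalElt p a) : Transcendental (ZMod p) (ι a) := by
  rintro ⟨f, hf, hfa⟩
  refine ha (f * Polynomial.X) (mul_ne_zero hf Polynomial.X_ne_zero) (by simp) (hι ?_)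
  rw [map_pEval ι a (by simp), map_mul, hfa, zero_mul, map_zero]

open Polynomial in
theorem MonicInVar.isIntegralElem {p : ℕ} [Fact p.Prime] {D : Type*} [CommRing D]
    [Algebra (ZMod p) D] {f : MvPolynomial (Fin 2) (ZMod p)} (hf : MonicInVar f 1) {a b : D}
    (h : MvPolynomial.aeval ![a, b] f = 0) :
    (aeval a : (ZMod p)[X] →ₐ[ZMod p] D).toRingHom.IsIntegralElem b := by
  set d := f.degreeOf 1
  have hd : Finsupp.single 1 d ∈ f.support := by
    rw [MvPolynomial.mem_support_iff, hf.1]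
    exact one_ne_zero
  refine ⟨X ^ d + ∑ m ∈ f.support.erase (Finsupp.single 1 d),
    C (monomial (m 0) (f.coeff m)) * X ^ m 1, monic_X_pow_add ?_, ?_⟩
  · refine (degree_sum_le _ _).trans_lt ((Finset.sup_lt_iff (WithBot.bot_lt_coe d)).mpr ?_)
    intro m hm
    obtain ⟨hne, hm⟩ := Finset.mem_erase.mp hm
    refine (degree_C_mul_X_pow_le _ _).trans_lt (WithBot.coe_lt_coe.mpr ?_)
    exact lt_of_le_of_ne (MvPolynomial.monomial_le_degreeOf 1 hm) fun e => hne (hf.2 m hm e)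
  · rw [MvPolynomial.aeval_def, MvPolynomial.eval₂_eq', ← Finset.add_sum_erase _ _ hd, hf.1] at h
    rw [eval₂_add, eval₂_finsetSum, ← h]
    simp [aeval_monomial, mul_assoc]

/-- A nonzero non-unital commutative ring of characteristic `p` without zero divisors embeds in a
domain generated by its image over `ZMod p`. -/
theorem exists_embedding_isDomain.{u} {K : Type u} [NonUnitalCommRing K] [Nontrivial K]
    {p : ℕ} [Fact p.Prime] (hchar : ∀ c : K, p • c = 0)
    (hnzd : ∀ x y : K, x ≠ 0 → y ≠ 0 → x * y ≠ 0) :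
    ∃ (D : Type u) (_ : CommRing D) (_ : IsDomain D) (_ : Algebra (ZMod p) D) (ι : K →ₙ+* D),
      Function.Injective ι ∧ ∀ x : D, ∃ (r : ZMod p) (k : K), x = algebraMap (ZMod p) D r + ι k := by
  let _ : Module (ZMod p) K := AddCommGroup.zmodModule hchar
  have : IsScalarTower (ZMod p) K K :=
    ⟨fun r x y => (ZMod.map_smul (AddMonoidHom.mulRight y) r x)⟩
  have : SMulCommClass (ZMod p) K K :=
    ⟨fun r x y => (ZMod.map_smul (AddMonoidHom.mulLeft x) r y).symm⟩
  let act (x : Unitization (ZMod p) K) (k : K) : K := x.fst • k + x.snd * k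
  have hact (x : Unitization (ZMod p) K) (k : K) :
      x * (k : Unitization (ZMod p) K) = (act x k : Unitization (ZMod p) K) := by
    ext <;> simp [act]
  have hinr : Function.Injective ((↑) : K → Unitization (ZMod p) K) := Unitization.inr_injective
  let J : Ideal (Unitization (ZMod p) K) :=
    { carrier := {x | ∀ k : K, x * (k : Unitization (ZMod p) K) = 0}
      add_mem' := fun hx hy k => by rw [add_mul, hx k, hy k, add_zero]
      zero_mem' := fun k => zero_mul _
      smul_mem' := fun c x hx k => by rw [smul_eq_mul, mul_assoc, hx k, mul_zero] }
  have hmemJ (x : Unitization (ZMod p) K) :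
      x ∈ J ↔ ∀ k : K, x * (k : Unitization (ZMod p) K) = 0 := Iff.rfl
  have hJK (k : K) (hk : (k : Unitization (ZMod p) K) ∈ J) : k = 0 := by
    by_contra hk0
    refine hnzd k k hk0 hk0 (hinr ?_)
    simpa using hk k
  obtain ⟨k₀, hk₀⟩ := exists_ne (0 : K)
  have hJ : J.IsPrime := by
    refine Ideal.isPrime_iff.mpr ⟨fun h => hk₀ (hJK k₀ (h ▸ Submodule.mem_top)), ?_⟩
    intro x y hxy
    by_contra! hne
    simp only [hmemJ, not_forall] at hne
    obtain ⟨⟨k, hk⟩, l, hl⟩ := hne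
    rw [hact] at hk hl
    refine hnzd (act x k) (act y l) (fun h => hk (by simp [h])) (fun h => hl (by simp [h]))
      (hinr ?_)
    have : x * y * ((k * l : K) : Unitization (ZMod p) K) = 0 := hxy (k * l)
    rw [Unitization.inr_mul, ← hact, ← hact]
    simpa [mul_mul_mul_comm] using this
  let ι : K →ₙ+* Unitization (ZMod p) K ⧸ J :=
    (Ideal.Quotient.mk J).toNonUnitalRingHom.comp
      (Unitization.inrNonUnitalAlgHom (ZMod p) K : K →ₙ+* Unitization (ZMod p) K)
  refine ⟨Unitization (ZMod p) K ⧸ J, inferInstance, Ideal.Quotient.isDomain J, inferInstance,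
    ι, ?_, ?_⟩
  · rw [injective_iff_map_eq_zero]
    exact fun k hk => hJK k (Ideal.Quotient.eq_zero_iff_mem.mp hk)
  · intro x
    obtain ⟨x, rfl⟩ := Ideal.Quotient.mk_surjective x
    refine ⟨x.fst, x.snd, ?_⟩
    conv_lhs => rw [← Unitization.inl_fst_add_inr_snd_eq x, map_add]
    rfl

/-- Separation by an ideal of finite index in a ring containing `K` gives separation by a
homomorphism to a finite ring. -/
theorem exists_finite_ring_of_ideal {K D : Type*} [NonUnitalRing K] [CommRing D] (ι : K →ₙ+* D)
    {A : Set K} {c : K} {I : Ideal D} [Finite (D ⧸ I)] (h : ∀ s ∈ A, ι c - ι s ∉ I) :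
    ∃ (F : Type) (_ : NonUnitalRing F) (_ : Finite F) (φ : K →ₙ+* F), φ c ∉ φ '' A := by
  let e : Shrink.{0} (D ⧸ I) ≃+* D ⧸ I := Shrink.ringEquiv.{0} (D ⧸ I)
  refine ⟨Shrink.{0} (D ⧸ I), inferInstance, Finite.of_equiv _ e.symm.toEquiv,
    (e.symm.toRingHom.comp (Ideal.Quotient.mk I)).toNonUnitalRingHom.comp ι, ?_⟩
  rintro ⟨s, hs, hsc⟩
  have : Ideal.Quotient.mk I (ι s) = Ideal.Quotient.mk I (ι c) := e.symm.injective hsc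
  exact h s hs (Ideal.Quotient.eq.mp this.symm)

/-- A finitely generated commutative (not necessarily unital) ring of prime
characteristic `p` without zero divisors in which any two transcendental elements are
integrally dependent is finitely separable. -/
theorem stmt9 {K : Type*} [NonUnitalCommRing K]
    (hfg : ∃ S : Finset K, NonUnitalSubring.closure (S : Set K) = ⊤)
    (p : ℕ) (hp : p.Prime) (hchar : ∀ c : K, p • c = 0)
    (hnzd : ∀ x y : K, x ≠ 0 → y ≠ 0 → x * y ≠ 0)
    (hdep : ∀ a b : K, IsTranscendentalElt p a → IsTranscendentalElt p b →
      IntegrallyDependent p a b) :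
    FinitelySeparable K := by
  intro c A hc
  have : Fact p.Prime := ⟨hp⟩
  have : Nontrivial K := ⟨c, 0, fun h => hc (h ▸ A.zero_mem)⟩
  obtain ⟨D, _, _, _, ι, hι, hgen⟩ := exists_embedding_isDomain hchar hnzd
  have hft : Algebra.FiniteType (ZMod p) D := by
    obtain ⟨S, hS⟩ := hfg
    classical
    refine ⟨S.image ι, eq_top_iff.mpr ?_⟩
    rintro x -
    obtain ⟨r, k, rfl⟩ := hgen x
    refine add_mem (Subalgebra.algebraMap_mem _ r) ?_
    have hk : k ∈ NonUnitalSubring.closure (S : Set K) := hS ▸ NonUnitalSubring.mem_top k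
    induction hk using NonUnitalSubring.closure_induction with
    | mem x hx => exact Algebra.subset_adjoin (by simpa using ⟨x, hx, rfl⟩)
    | zero => rw [map_zero]; exact zero_mem _
    | add x y _ _ hx hy => rw [map_add]; exact add_mem hx hy
    | neg x _ hx => rw [map_neg]; exact neg_mem hx
    | mul x y _ _ hx hy => rw [map_mul]; exact mul_mem hx hy
  have hintegral {a : K} (ha : IsTranscendentalElt p a) :
      (Polynomial.aeval (ι a) :
        Polynomial (ZMod p) →ₐ[ZMod p] D).toRingHom.IsIntegral := by
    have halg (z : D) (hz : IsIntegral (ZMod p) z) : (Polynomial.aeval (ι a) :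
        Polynomial (ZMod p) →ₐ[ZMod p] D).toRingHom.IsIntegralElem z := by
      obtain ⟨f, hf, hfz⟩ := hz
      refine ⟨f.map Polynomial.C, hf.map _, ?_⟩
      rw [Polynomial.eval₂_map, ← hfz]
      congr 1
      ext
      simp
    intro x
    obtain ⟨r, k, rfl⟩ := hgen x
    refine RingHom.IsIntegralElem.add _ (halg _ isIntegral_algebraMap) ?_
    by_cases hk : IsTranscendentalElt p k
    · obtain ⟨f, hf0, -, hf1, hfe⟩ := hdep a k ha hk
      exact hf1.isIntegralElem (by rw [← map_mvEval ι a k hf0, hfe, map_zero])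
    · exact halg _ (isAlgebraic_map_of_not_isTranscendentalElt ι hk).isIntegral
  suffices h : ∃ I : Ideal D, Finite (D ⧸ I) ∧ ∀ s ∈ A, ι c - ι s ∉ I by
    obtain ⟨I, _, hI⟩ := h
    exact exists_finite_ring_of_ideal ι hI
  by_cases htr : ∃ a : K, IsTranscendentalElt p a
  · by_cases hA : ∃ a ∈ A, IsTranscendentalElt p a
    · obtain ⟨a, haA, ha⟩ := hA
      obtain ⟨I, hI, hs⟩ := exists_finite_quotient_of_mul_mem (hintegral ha)
        (AddSubgroup.toZModSubmodule p (A.map ι).toAddSubgroup) (c := ι c)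
        (by
          rintro _ ⟨x, hx, rfl⟩
          exact ⟨a * x, A.mul_mem haA hx, map_mul ι a x⟩)
        (by
          rintro ⟨x, hx, hxc⟩
          exact hc (hι hxc ▸ hx))
      exact ⟨I, hI, fun s hsA => hs _ ⟨s, hsA, rfl⟩⟩
    · obtain ⟨a, ha⟩ := htr
      push Not at hA
      obtain ⟨I, hI, hs⟩ := exists_finite_quotient_of_isIntegral (hintegral ha) (ha.map hι)
        (ι '' A) (c := ι c)
        (by
          rintro _ ⟨x, hx, rfl⟩
          exact (isAlgebraic_map_of_not_isTranscendentalElt ι (hA x hx)).isIntegral)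
        (by
          rintro ⟨x, hx, hxc⟩
          exact hc (hι hxc ▸ hx))
      exact ⟨I, hI, fun s hsA => hs _ ⟨s, hsA, rfl⟩⟩
  · push Not at htr
    have : Algebra.IsIntegral (ZMod p) D := by
      refine ⟨fun x => ?_⟩
      obtain ⟨r, k, rfl⟩ := hgen x
      exact isIntegral_algebraMap.add (isAlgebraic_map_of_not_isTranscendentalElt ι (htr k)).isIntegral
    have : Module.Finite (ZMod p) D := Algebra.IsIntegral.finite
    have : Finite D := Module.finite_of_finite (ZMod p)
    refine ⟨⊥, Finite.of_surjective _ Ideal.Quotient.mk_surjective, fun s hs h => hc ?_⟩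
    rwa [hι (sub_eq_zero.mp (Ideal.mem_bot.mp h))]
end

section
/- For every finite field C_p, the polynomial ring C_p[x] in one variable over C_p is finitely separable. -/
open Polynomial

/-- Over a Noetherian ring with finite residue fields, finitely generated modules have closed
submodules in the topology defined by the ideals of finite index. -/
theorem Submodule.exists_notMem_sup_smul_top {R M : Type*} [CommRing R] [IsNoetherianRing R]
    (hR : ∀ P : Ideal R, P.IsMaximal → Finite (R ⧸ P)) [AddCommGroup M] [Module R M]
    [Module.Finite R M] (N : Submodule R M) {a : M} (ha : a ∉ N) :
    ∃ I : Ideal R, Finite (R ⧸ I) ∧ a ∉ N ⊔ I • ⊤ := by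
  set b : M ⧸ N := N.mkQ a with hb
  have hb0 : b ≠ 0 := by simpa [hb] using ha
  obtain ⟨P, hP, hle⟩ := Ideal.exists_le_maximal (LinearMap.ker (LinearMap.toSpanSingleton R _ b))
    (by rw [Ideal.ne_top_iff_one, LinearMap.mem_ker, LinearMap.toSpanSingleton_apply, one_smul]
        exact hb0)
  have hmem : b ∉ (⨅ i : ℕ, P ^ i • ⊤ : Submodule R (M ⧸ N)) := by
    rw [Ideal.mem_iInf_smul_pow_eq_bot_iff]
    rintro ⟨r, hr⟩
    have h1 : (1 - r : R) ∈ P := hle (by simp [sub_smul, hr])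
    exact hP.ne_top ((Ideal.eq_top_iff_one P).2 (by simpa using P.add_mem h1 r.2))
  simp only [Submodule.mem_iInf, not_forall] at hmem
  obtain ⟨n, hn⟩ := hmem
  have := hR P hP
  refine ⟨P ^ n, Ideal.finite_quotient_pow (IsNoetherian.noetherian P) n, fun h ↦ hn ?_⟩
  have h2 := Submodule.mem_map_of_mem (f := N.mkQ) h
  rwa [Submodule.map_sup, N.mkQ_map_self, bot_sup_eq, Submodule.map_smul'', Submodule.map_top,
    Submodule.range_mkQ] at h2

/-- A finitely generated algebra over a finite field has finite residue fields. -/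
theorem Ideal.IsMaximal.finite_quotient (k : Type*) {R : Type*} [Field k] [Finite k] [CommRing R]
    [Algebra k R] [Algebra.FiniteType k R] {P : Ideal R} (hP : P.IsMaximal) : Finite (R ⧸ P) := by
  let := Ideal.Quotient.field P
  have := finite_of_finite_type_of_isJacobsonRing k (R ⧸ P)
  exact Module.finite_of_finite k

/-- If `L / k` is algebraic, then `L[X]` is integral over `k[f]` for every nonconstant `f`. -/
theorem Polynomial.isIntegral_adjoin_singleton {k L : Type*} [Field k] [Field L] [Algebra k L]
    [Algebra.IsAlgebraic k L] {f : L[X]} (hf : f.natDegree ≠ 0) :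
    Algebra.IsIntegral (Algebra.adjoin k {f}) L[X] := by
  set R := Algebra.adjoin k {f}
  have hC (c : L) : C c ∈ integralClosure R L[X] := by
    have h : IsIntegral k c := Algebra.IsIntegral.isIntegral c
    exact (h.map (IsScalarTower.toAlgHom k L L[X])).tower_top
  have hfR : f ∈ integralClosure R L[X] :=
    isIntegral_algebraMap (x := (⟨f, Algebra.self_mem_adjoin_singleton k f⟩ : R))
  have hX : X ∈ integralClosure R L[X] := by
    let φ : L →+* integralClosure R L[X] := (C : L →+* L[X]).codRestrict _ hC
    let _ : CommRing (integralClosure R L[X]) := inferInstance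
    have hf0 : f ≠ 0 := by rintro rfl; simp at hf
    have hm : ((f * C f.leadingCoeff⁻¹).map φ).Monic := (monic_mul_leadingCoeff_inv hf0).map φ
    let g : integralClosure R L[X] := ⟨f * C f.leadingCoeff⁻¹, mul_mem hfR (hC _)⟩
    refine isIntegral_trans (A := integralClosure R L[X]) (X : L[X])
      ⟨(f * C f.leadingCoeff⁻¹).map φ - C g, hm.sub_of_left ?_, ?_⟩
    · refine degree_C_le.trans_lt ?_
      rw [degree_map_eq_of_injective φ.injective, degree_mul_leadingCoeff_inv f hf0]
      exact natDegree_pos_iff_degree_pos.1 (Nat.pos_of_ne_zero hf)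
    · rw [eval₂_sub, eval₂_map, eval₂_C]
      have : (algebraMap (integralClosure R L[X]) L[X]).comp φ = C := rfl
      rw [this, eval₂_C_X]
      exact sub_self _
  refine ⟨fun q ↦ ?_⟩
  change q ∈ integralClosure R L[X]
  induction q using Polynomial.induction_on' with
  | add p q hp hq => exact add_mem hp hq
  | monomial n c =>
    rw [← C_mul_X_pow_eq_monomial]
    exact mul_mem (hC c) (pow_mem hX n)

/-- A point lying outside a subring modulo an ideal of finite index is separated from it. -/
theorem Ideal.exists_finite_separating {K : Type*} [CommRing K] (J : Ideal K) [Finite (K ⧸ J)]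
    (A : NonUnitalSubring K) (a : K) (h : ∀ b ∈ A, b - a ∉ J) :
    ∃ (F : Type) (_ : NonUnitalRing F) (_ : Finite F) (φ : K →ₙ+* F),
      φ a ∉ φ '' (A : Set K) := by
  let e : Shrink.{0} (K ⧸ J) ≃+* K ⧸ J := Shrink.ringEquiv _
  refine ⟨Shrink.{0} (K ⧸ J), inferInstance, Finite.of_equiv _ e.symm.toEquiv,
    ((e.symm : K ⧸ J →+* Shrink.{0} (K ⧸ J)).comp (Ideal.Quotient.mk J) :
      K →ₙ+* Shrink.{0} (K ⧸ J)), ?_⟩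
  rintro ⟨b, hb, hba⟩
  exact h b hb (Ideal.Quotient.eq.1 (e.symm.injective hba))

/-- A subring of a polynomial ring over a finite field containing a nonconstant polynomial is
closed in the topology defined by the ideals of finite index. -/
theorem NonUnitalSubring.exists_ideal_of_natDegree_ne_zero {L : Type*} [Field L] [Finite L]
    (A : NonUnitalSubring L[X]) {a f : L[X]} (ha : a ∉ A) (hfA : f ∈ A) (hf : f.natDegree ≠ 0) :
    ∃ J : Ideal L[X], Finite (L[X] ⧸ J) ∧ ∀ b ∈ A, b - a ∉ J := by
  obtain ⟨p, _⟩ := CharP.exists L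
  have : Fact p.Prime := ⟨CharP.char_is_prime L p⟩
  let := ZMod.algebra L p
  have : Module.Finite (ZMod p) L := Module.Finite.of_finite
  set R := Algebra.adjoin (ZMod p) {f}
  have : Algebra.FiniteType (ZMod p) R :=
    (Subalgebra.fg_iff_finiteType R).1 (by simpa [R] using Subalgebra.fg_adjoin_finset {f})
  have : IsNoetherianRing R := Algebra.FiniteType.isNoetherianRing (ZMod p) R
  have : Algebra.IsIntegral R L[X] := isIntegral_adjoin_singleton hf
  have : Algebra.FiniteType (ZMod p) L[X] := .trans (S := L) inferInstance inferInstance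
  have : Algebra.FiniteType R L[X] := .of_restrictScalars_finiteType (ZMod p) R L[X]
  have : Module.Finite R L[X] := Algebra.IsIntegral.finite
  have hmul (r : L[X]) (hr : r ∈ R) : ∀ x ∈ A, r * x ∈ A := by
    induction hr using Algebra.adjoin_induction with
    | mem y hy => rw [Set.mem_singleton_iff.1 hy]; exact fun x hx ↦ mul_mem hfA hx
    | algebraMap c =>
      intro x hx
      rw [← ZMod.natCast_zmod_val c, map_natCast, ← nsmul_eq_mul]
      exact nsmul_mem hx _
    | add y z _ _ hy hz =>
      intro x hx
      rw [add_mul]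
      exact add_mem (hy x hx) (hz x hx)
    | mul y z _ _ hy hz =>
      intro x hx
      rw [mul_assoc]
      exact hy _ (hz x hx)
  let N : Submodule R L[X] :=
    { A.toAddSubgroup with smul_mem' := fun r x hx ↦ hmul r r.2 x hx }
  obtain ⟨I, hI, haI⟩ := N.exists_notMem_sup_smul_top
    (fun P hP ↦ hP.finite_quotient (ZMod p)) (a := a) ha
  have hfin : Finite (L[X] ⧸ (I • ⊤ : Submodule R L[X])) :=
    Submodule.finite_quotient_smul I Module.Finite.fg_top
  rw [Ideal.smul_top_eq_map] at hfin haI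
  refine ⟨I.map (algebraMap R L[X]), hfin, fun b hb hba ↦ haI ?_⟩
  rw [← sub_sub_cancel b a]
  exact sub_mem (Submodule.mem_sup_left hb) (Submodule.mem_sup_right hba)

/-- For every finite field `C_p`, the polynomial ring `C_p[x]` is finitely
separable. -/
theorem stmt10 (Cp : Type*) [Field Cp] [Finite Cp] :
    FinitelySeparable (Polynomial Cp) := by
  intro a A ha
  suffices ∃ J : Ideal Cp[X], Finite (Cp[X] ⧸ J) ∧ ∀ b ∈ A, b - a ∉ J by
    obtain ⟨J, _, hJ⟩ := this
    exact J.exists_finite_separating A a hJ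
  by_cases h : ∃ f ∈ A, f.natDegree ≠ 0
  · obtain ⟨f, hfA, hf⟩ := h
    exact A.exists_ideal_of_natDegree_ne_zero ha hfA hf
  · push Not at h
    have hm : (X ^ (a.natDegree + 1) : Cp[X]).Monic := monic_X_pow _
    have := hm.finite_quotient
    refine ⟨Ideal.span {X ^ (a.natDegree + 1)}, Module.finite_of_finite Cp, fun b hb hba ↦ ?_⟩
    rw [Ideal.mem_span_singleton] at hba
    have hdeg : (b - a).natDegree < (X ^ (a.natDegree + 1) : Cp[X]).natDegree := by
      rw [natDegree_X_pow, Nat.lt_succ_iff]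
      exact (natDegree_sub_le b a).trans (by simp [h b hb])
    have h0 : b - a = 0 := by
      by_contra hne
      exact hdeg.not_ge (natDegree_le_of_dvd hba hne)
    exact ha (sub_eq_zero.1 h0 ▸ hb)
end

section
/- The ring K = Z_3⟨a, b ∣ a² + b − b² = 0⟩ is not finitely separable. -/
/-- The non-unital ring of polynomials in two variables over `Z_p` with zero constant term. -/
def zeroConstSubring (p : ℕ) : NonUnitalSubring (MvPolynomial (Fin 2) (ZMod p)) where
  carrier := {f | MvPolynomial.constantCoeff f = 0}
  add_mem' := by intro f g hf hg; simp_all [Set.mem_setOf_eq, map_add]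
  zero_mem' := by simp
  neg_mem' := by intro f hf; simp_all [Set.mem_setOf_eq]
  mul_mem' := by intro f g hf hg; simp_all [Set.mem_setOf_eq, map_mul]

lemma mem_zeroConstSubring (p : ℕ) (f : MvPolynomial (Fin 2) (ZMod p)) :
    f ∈ zeroConstSubring p ↔ MvPolynomial.constantCoeff f = 0 := Iff.rfl

/-- The ring `Z_p⟨a, b ∣ f (a, b) = 0⟩`: the quotient of the non-unital ring of two-variable
polynomials over `Z_p` with zero constant term by the (two-sided) ideal generated by `f`. -/
noncomputable def relRing (p : ℕ) (f : MvPolynomial (Fin 2) (ZMod p))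
    (hf : MvPolynomial.constantCoeff f = 0) : Type :=
  (TwoSidedIdeal.span {(⟨f, hf⟩ : zeroConstSubring p)}).ringCon.Quotient

noncomputable instance (p : ℕ) (f : MvPolynomial (Fin 2) (ZMod p))
    (hf : MvPolynomial.constantCoeff f = 0) : NonUnitalRing (relRing p f hf) := by
  unfold relRing; infer_instance

/-- The image `a` of the variable `x` in `Z_p⟨a, b ∣ f (a, b) = 0⟩`. -/
noncomputable def relRingA (p : ℕ) (f : MvPolynomial (Fin 2) (ZMod p))
    (hf : MvPolynomial.constantCoeff f = 0) : relRing p f hf :=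
  ((⟨MvPolynomial.X 0, by rw [mem_zeroConstSubring]; simp⟩ : zeroConstSubring p) :
    (TwoSidedIdeal.span {(⟨f, hf⟩ : zeroConstSubring p)}).ringCon.Quotient)

/-- The image `b` of the variable `y` in `Z_p⟨a, b ∣ f (a, b) = 0⟩`. -/
noncomputable def relRingB (p : ℕ) (f : MvPolynomial (Fin 2) (ZMod p))
    (hf : MvPolynomial.constantCoeff f = 0) : relRing p f hf :=
  ((⟨MvPolynomial.X 1, by rw [mem_zeroConstSubring]; simp⟩ : zeroConstSubring p) :
    (TwoSidedIdeal.span {(⟨f, hf⟩ : zeroConstSubring p)}).ringCon.Quotient)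

lemma relPoly_mem (p : ℕ) :
    MvPolynomial.constantCoeff
      (MvPolynomial.X 0 ^ 2 + MvPolynomial.X 1 - MvPolynomial.X 1 ^ 2 :
        MvPolynomial (Fin 2) (ZMod p)) = 0 := by
  simp

/-- The ring `Z_p⟨a, b ∣ a² + b − b² = 0⟩`. -/
noncomputable def exK (p : ℕ) : Type :=
  relRing p (MvPolynomial.X 0 ^ 2 + MvPolynomial.X 1 - MvPolynomial.X 1 ^ 2) (relPoly_mem p)

noncomputable instance (p : ℕ) : NonUnitalRing (exK p) := by
  unfold exK; infer_instance

/-- The generator `a` of `Z_p⟨a, b ∣ a² + b − b² = 0⟩`. -/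
noncomputable def exA (p : ℕ) : exK p :=
  relRingA p (MvPolynomial.X 0 ^ 2 + MvPolynomial.X 1 - MvPolynomial.X 1 ^ 2) (relPoly_mem p)

/-- The generator `b` of `Z_p⟨a, b ∣ a² + b − b² = 0⟩`. -/
noncomputable def exB (p : ℕ) : exK p :=
  relRingB p (MvPolynomial.X 0 ^ 2 + MvPolynomial.X 1 - MvPolynomial.X 1 ^ 2) (relPoly_mem p)

/-- The quotient map from polynomials with zero constant term onto `relRing p f hf`. -/
noncomputable def relRingMk (p : ℕ) (f : MvPolynomial (Fin 2) (ZMod p))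
    (hf : MvPolynomial.constantCoeff f = 0) : zeroConstSubring p →ₙ+* relRing p f hf where
  toFun g := (g : (TwoSidedIdeal.span {(⟨f, hf⟩ : zeroConstSubring p)}).ringCon.Quotient)
  map_mul' _ _ := rfl
  map_zero' := rfl
  map_add' _ _ := rfl

lemma relRingMk_self (p : ℕ) (f : MvPolynomial (Fin 2) (ZMod p))
    (hf : MvPolynomial.constantCoeff f = 0) : relRingMk p f hf ⟨f, hf⟩ = 0 :=
  Quotient.sound' (TwoSidedIdeal.subset_span (Set.mem_singleton _))

/-- The homomorphism out of `relRing p f hf` induced by a homomorphism killing `f`. -/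
noncomputable def relRingLift (p : ℕ) (f : MvPolynomial (Fin 2) (ZMod p))
    (hf : MvPolynomial.constantCoeff f = 0) {P : Type*} [NonUnitalRing P]
    (g : zeroConstSubring p →ₙ+* P) (hg : g ⟨f, hf⟩ = 0) : relRing p f hf →ₙ+* P :=
  have key : ∀ x y, (TwoSidedIdeal.span {(⟨f, hf⟩ : zeroConstSubring p)}).ringCon x y →
      g x = g y := fun x y h => by
    have hle : TwoSidedIdeal.span {(⟨f, hf⟩ : zeroConstSubring p)} ≤ TwoSidedIdeal.ker g :=
      TwoSidedIdeal.span_le.2 (by simpa [TwoSidedIdeal.mem_ker] using hg)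
    rw [TwoSidedIdeal.rel_iff] at h
    exact (TwoSidedIdeal.ker_ringCon g).1 ((TwoSidedIdeal.rel_iff _ x y).2 (hle h))
  { toFun := fun x => Quotient.liftOn' x g key
    map_mul' := fun x y => Quotient.inductionOn₂' x y fun a b => map_mul g a b
    map_zero' := map_zero g
    map_add' := fun x y => Quotient.inductionOn₂' x y fun a b => map_add g a b }

lemma relRingLift_mk (p : ℕ) (f : MvPolynomial (Fin 2) (ZMod p))
    (hf : MvPolynomial.constantCoeff f = 0) {P : Type*} [NonUnitalRing P]
    (g : zeroConstSubring p →ₙ+* P) (hg : g ⟨f, hf⟩ = 0) (x : zeroConstSubring p) :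
    relRingLift p f hf g hg (relRingMk p f hf x) = g x := rfl

/-- A subring containing `x` meets every fibre of a homomorphism to a finite ring that contains
a quasi-inverse of `x`. -/
lemma map_mem_image_of_quasiInverse {K F : Type*} [NonUnitalRing K] [NonUnitalRing F] [Finite F]
    (φ : K →ₙ+* F) (A : NonUnitalSubring K) {x w : K} (hx : x ∈ A)
    (hxw : w + x + x * w = 0) (hwx : x + w + w * x = 0) : φ w ∈ φ '' (A : Set K) := by
  have : Finite (PreQuasiregular F) := Finite.of_equiv F PreQuasiregular.equiv
  let u : (PreQuasiregular F)ˣ :=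
    { val := .mk (φ x)
      inv := .mk (φ w)
      val_inv := PreQuasiregular.equiv.symm.injective <| by
        simpa using congr(φ $hxw)
      inv_val := PreQuasiregular.equiv.symm.injective <| by
        simpa using congr(φ $hwx) }
  have hpow (n : ℕ) : ((u ^ n : (PreQuasiregular F)ˣ) : PreQuasiregular F).val
      ∈ φ '' (A : Set K) := by
    induction n with
    | zero => exact ⟨0, A.zero_mem, by simp⟩
    | succ n ih =>
      obtain ⟨t, ht, htu⟩ := ih
      refine ⟨x + t + t * x, A.add_mem (A.add_mem hx ht) (A.mul_mem ht hx), ?_⟩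
      rw [pow_succ, Units.val_mul, PreQuasiregular.val_mul, ← htu]
      simp [u]
  obtain ⟨n, hn⟩ := (mem_powers_iff_mem_zpowers (x := u)).2
    (Subgroup.inv_mem _ (Subgroup.mem_zpowers u))
  have h := hpow n
  rw [show u ^ n = u⁻¹ from hn] at h
  exact h

open LaurentPolynomial in
lemma T_neg_one_sub_one_notMem_range_toLaurent {R : Type*} [CommRing R] [Nontrivial R] :
    (T (-1) - 1 : R[T;T⁻¹]) ∉ (Polynomial.toLaurent (R := R)).range := by
  rintro ⟨f, hf⟩
  have h : Polynomial.toLaurent (f * Polynomial.X) =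
      Polynomial.toLaurent (1 - Polynomial.X : Polynomial R) := by
    rw [map_mul, hf, map_sub, Polynomial.toLaurent_X, sub_mul, ← T_add, map_one]
    simp
  simpa using congr(Polynomial.eval 0 $(Polynomial.toLaurent_injective h))

lemma three_eq_zero_of_algebra (R : Type*) [CommRing R] [Algebra (ZMod 3) R] : (3 : R) = 0 := by
  rw [← map_ofNat (algebraMap (ZMod 3) R) 3, show (OfNat.ofNat 3 : ZMod 3) = 0 from rfl, map_zero]

/-- Evaluation of polynomials with zero constant term at `(x 0, x 1)`. -/
noncomputable def zeroConstAeval (p : ℕ) {R : Type*} [CommRing R] [Algebra (ZMod p) R]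
    (x : Fin 2 → R) : zeroConstSubring p →ₙ+* R :=
  (MvPolynomial.aeval x : MvPolynomial (Fin 2) (ZMod p) →ₐ[ZMod p] R).toRingHom.toNonUnitalRingHom.comp
    (NonUnitalSubringClass.subtype (zeroConstSubring p))

lemma zeroConstAeval_mk (p : ℕ) {R : Type*} [CommRing R] [Algebra (ZMod p) R] (x : Fin 2 → R)
    (f : MvPolynomial (Fin 2) (ZMod p)) (hf : f ∈ zeroConstSubring p) :
    zeroConstAeval p x ⟨f, hf⟩ = MvPolynomial.aeval x f := rfl

open LaurentPolynomial in
/-- The homomorphism `Z_3⟨a, b ∣ a² + b − b² = 0⟩ → Z_3[T, T⁻¹]` with `a ↦ T⁻¹ - T` and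
`b ↦ -(T + T⁻¹ + 1)`, so that `b + a ↦ T - 1` and `b - a ↦ T⁻¹ - 1`. -/
noncomputable def exKToLaurent : exK 3 →ₙ+* (ZMod 3)[T;T⁻¹] :=
  relRingLift 3 _ (relPoly_mem 3)
    (zeroConstAeval 3 ![T (-1) - T 1, -(T 1 + T (-1) + 1)]) (by
    have h3 := three_eq_zero_of_algebra (ZMod 3)[T;T⁻¹]
    have hT : (T 1 * T (-1) : (ZMod 3)[T;T⁻¹]) = 1 := by rw [← T_add]; simp
    refine (zeroConstAeval_mk 3 _ _ (relPoly_mem 3)).trans ?_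
    simp only [map_sub, map_add, map_pow, MvPolynomial.aeval_X, Matrix.cons_val_zero,
      Matrix.cons_val_one]
    linear_combination (-T 1 - T (-1) - 2) * h3 - 4 * hT)

open LaurentPolynomial in
lemma exKToLaurent_exA : exKToLaurent (exA 3) = T (-1) - T 1 :=
  (zeroConstAeval_mk 3 _ _ _).trans (MvPolynomial.aeval_X _ _)

open LaurentPolynomial in
lemma exKToLaurent_exB : exKToLaurent (exB 3) = -(T 1 + T (-1) + 1) :=
  (zeroConstAeval_mk 3 _ _ _).trans (MvPolynomial.aeval_X _ _)

open LaurentPolynomial in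
lemma exKToLaurent_exB_add_exA : exKToLaurent (exB 3 + exA 3) = T 1 - 1 := by
  rw [map_add, exKToLaurent_exA, exKToLaurent_exB]
  linear_combination -T 1 * three_eq_zero_of_algebra (ZMod 3)[T;T⁻¹]

open LaurentPolynomial in
lemma exKToLaurent_exB_sub_exA : exKToLaurent (exB 3 - exA 3) = T (-1) - 1 := by
  rw [map_sub, exKToLaurent_exA, exKToLaurent_exB]
  linear_combination -T (-1) * three_eq_zero_of_algebra (ZMod 3)[T;T⁻¹]

lemma exK_mul_comm (p : ℕ) (x y : exK p) : x * y = y * x :=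
  Quotient.inductionOn₂' x y fun _ _ => congrArg _ (Subtype.ext (mul_comm _ _))

lemma exB_sub_exA_quasiInverse :
    exB 3 - exA 3 + (exB 3 + exA 3) + (exB 3 + exA 3) * (exB 3 - exA 3) = 0 := by
  let q := relRingMk 3 _ (relPoly_mem 3)
  let X (i : Fin 2) : zeroConstSubring 3 := ⟨MvPolynomial.X i, by simp [mem_zeroConstSubring]⟩
  have hq : X 1 - X 0 + (X 1 + X 0) + (X 1 + X 0) * (X 1 - X 0) =
      -(⟨_, relPoly_mem 3⟩ : zeroConstSubring 3) := by
    apply Subtype.ext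
    change (MvPolynomial.X 1 - MvPolynomial.X 0 + (MvPolynomial.X 1 + MvPolynomial.X 0) +
      (MvPolynomial.X 1 + MvPolynomial.X 0) * (MvPolynomial.X 1 - MvPolynomial.X 0) :
        MvPolynomial (Fin 2) (ZMod 3)) =
      -(MvPolynomial.X 0 ^ 2 + MvPolynomial.X 1 - MvPolynomial.X 1 ^ 2)
    linear_combination MvPolynomial.X 1 * three_eq_zero_of_algebra (MvPolynomial (Fin 2) (ZMod 3))
  have h := congr(q $hq)
  rw [map_neg q, relRingMk_self, neg_zero] at h
  exact h

/-- The ring `K = Z_3⟨a, b ∣ a² + b − b² = 0⟩` is not finitely separable. -/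
theorem stmt12 : ¬ FinitelySeparable (exK 3) := by
  intro h
  let A : NonUnitalSubring (exK 3) :=
    (Polynomial.toLaurent (R := ZMod 3)).range.toNonUnitalSubring.comap exKToLaurent
  obtain ⟨F, _, _, φ, hφ⟩ := h (exB 3 - exA 3) A fun hw =>
    T_neg_one_sub_one_notMem_range_toLaurent (R := ZMod 3) (exKToLaurent_exB_sub_exA ▸ hw)
  refine hφ (map_mem_image_of_quasiInverse φ A (x := exB 3 + exA 3) ?_ exB_sub_exA_quasiInverse ?_)
  · change exKToLaurent _ ∈ (Polynomial.toLaurent (R := ZMod 3)).range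
    rw [exKToLaurent_exB_add_exA]
    exact ⟨Polynomial.X - 1, by simp⟩
  · rw [exK_mul_comm, add_comm (exB 3 + exA 3)]
    exact exB_sub_exA_quasiInverse
end

section
/- The ring K = Z_2⟨a, b ∣ a² + b − b² = 0⟩ is finitely separable. -/
/-- An element `m` of a finite module `M` over a Noetherian domain outside a submodule `N` is
outside `N + q • M` for some nonzero scalar `q`. -/
theorem exists_ne_zero_forall_sub_smul_notMem {R M : Type*} [CommRing R] [IsDomain R]
    [IsNoetherianRing R] (hR : ¬ IsField R) [AddCommGroup M] [Module R M] [Module.Finite R M]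
    (N : Submodule R M) {m : M} (hm : m ∉ N) :
    ∃ q : R, q ≠ 0 ∧ ∀ x : M, m - q • x ∉ N := by
  by_contra! H
  set v : M ⧸ N := N.mkQ m with hv
  have hv0 : v ≠ 0 := by simpa [hv] using hm
  obtain ⟨I, hI, hle⟩ := Ideal.exists_le_maximal (Ideal.torsionOf R (M ⧸ N) v)
    (by rwa [Ne, Ideal.torsionOf_eq_top_iff])
  have hI0 : I ≠ ⊥ := Ring.ne_bot_of_isMaximal_of_not_isField hI hR
  have hmem : v ∈ (⨅ i : ℕ, I ^ i • ⊤ : Submodule R (M ⧸ N)) := by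
    rw [Submodule.mem_iInf]
    intro i
    obtain ⟨q, hq, hq0⟩ := Submodule.exists_mem_ne_zero_of_ne_bot (pow_ne_zero i hI0)
    obtain ⟨x, hx⟩ := H q hq0
    have : v = q • N.mkQ x := by
      rw [← sub_eq_zero, hv, ← map_smul, ← map_sub, Submodule.mkQ_apply]
      exact (Submodule.Quotient.mk_eq_zero N).2 hx
    rw [this]
    exact Submodule.smul_mem_smul hq trivial
  obtain ⟨r, hr⟩ := (I.mem_iInf_smul_pow_eq_bot_iff v).mp hmem
  have h1 : (1 - (r : R)) ∈ I := hle <| by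
    rw [Ideal.mem_torsionOf_iff, sub_smul, hr, one_smul, sub_self]
  exact hI.ne_top ((Ideal.eq_top_iff_one I).2 (by simpa using I.add_mem h1 r.2))

/-- A polynomial ring in one variable over a field is integral over the subalgebra generated by
any nonconstant polynomial. -/
theorem isIntegral_adjoin_singleton {k : Type*} [Field k] {h : Polynomial k}
    (hh : h.natDegree ≠ 0) :
    Algebra.IsIntegral (Algebra.adjoin k {h}) (Polynomial k) := by
  set R := Algebra.adjoin k {h}
  let h' : R := ⟨h, Algebra.self_mem_adjoin_singleton k h⟩
  have hX : IsIntegral R (Polynomial.X : Polynomial k) := by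
    have hdeg : 0 < (h.map (algebraMap k R)).natDegree := by
      rw [Polynomial.natDegree_map]; exact Nat.pos_of_ne_zero hh
    have hu : IsUnit (h.map (algebraMap k R) - Polynomial.C h').leadingCoeff := by
      rw [Polynomial.leadingCoeff_sub_of_degree_lt, Polynomial.leadingCoeff_map]
      · refine (IsUnit.mk0 _ ?_).map (algebraMap k R)
        intro h0
        rw [Polynomial.leadingCoeff_eq_zero] at h0
        simp [h0] at hh
      · exact Polynomial.degree_C_le.trans_lt (Polynomial.natDegree_pos_iff_degree_pos.1 hdeg)
    refine ⟨Polynomial.C (↑(hu.unit⁻¹) : R) * (h.map (algebraMap k R) - Polynomial.C h'), ?_, ?_⟩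
    · rw [mul_comm]
      refine Polynomial.monic_mul_C_of_leadingCoeff_mul_eq_one ?_
      exact hu.mul_val_inv
    · have hcomp : (algebraMap R (Polynomial k)).comp (algebraMap k R) = Polynomial.C :=
        (IsScalarTower.algebraMap_eq k R (Polynomial k)).symm
      rw [Polynomial.eval₂_mul, Polynomial.eval₂_sub, Polynomial.eval₂_map, hcomp,
        Polynomial.eval₂_C_X, Polynomial.eval₂_C]
      simp [h']
  refine ⟨fun x => ?_⟩
  induction x using Polynomial.induction_on' with
  | add p q hp hq => exact hp.add hq
  | monomial n a =>
    rw [← Polynomial.C_mul_X_pow_eq_monomial]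
    refine IsIntegral.mul ?_ (hX.pow n)
    exact isIntegral_algebraMap (R := R) (A := Polynomial k) (x := algebraMap k R a)

/-- An element outside a subspace stable under multiplication by a nonconstant polynomial is
outside it modulo some nonzero principal ideal. -/
theorem Polynomial.exists_ne_zero_forall_sub_mul_notMem {k : Type*} [Field k] {h : Polynomial k}
    (hh : h.natDegree ≠ 0) (A : Submodule k (Polynomial k)) (hA : ∀ x ∈ A, h * x ∈ A)
    {a : Polynomial k} (ha : a ∉ A) :
    ∃ q : Polynomial k, q ≠ 0 ∧ ∀ x, a - q * x ∉ A := by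
  let R := Algebra.adjoin k {h}
  have : Algebra.IsIntegral R (Polynomial k) := isIntegral_adjoin_singleton hh
  have : Algebra.FiniteType R (Polynomial k) :=
    Algebra.FiniteType.of_restrictScalars_finiteType k R (Polynomial k)
  have : Module.Finite R (Polynomial k) := Algebra.IsIntegral.finite
  have : IsNoetherianRing R :=
    have : Algebra.FiniteType k R :=
      Algebra.FiniteType.adjoin_of_finite (Set.finite_singleton h)
    Algebra.FiniteType.isNoetherianRing k R
  have hR : ¬ IsField R := fun hF =>
    Polynomial.not_isField k (isField_of_isIntegral_of_isField' hF)
  let N : Submodule R (Polynomial k) :=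
    { A with
      smul_mem' := by
        rintro ⟨c, hc⟩
        change ∀ x ∈ A, c * x ∈ A
        induction hc using Algebra.adjoin_induction with
        | mem y hy => rwa [Set.mem_singleton_iff.1 hy]
        | algebraMap r => intro x hx; rw [← Algebra.smul_def]; exact A.smul_mem r hx
        | add y z _ _ hy hz => intro x hx; rw [add_mul]; exact A.add_mem (hy x hx) (hz x hx)
        | mul y z _ _ hy hz => intro x hx; rw [mul_assoc]; exact hy _ (hz x hx) }
  obtain ⟨q, hq, hqN⟩ := _root_.exists_ne_zero_forall_sub_smul_notMem hR N (m := a) ha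
  exact ⟨q, by simpa using hq, hqN⟩

/-- A non-unital ring embedded in the ring of polynomials without constant term
over `ZMod p` is finitely separable. -/
theorem finitelySeparable_of_injective {p : ℕ} [Fact p.Prime] {K : Type*} [NonUnitalRing K]
    (ψ : K →ₙ+* Polynomial (ZMod p)) (hψ : Function.Injective ψ)
    (hψ0 : ∀ x, (ψ x).coeff 0 = 0) : FinitelySeparable K := by
  intro a A ha
  let B : Submodule (ZMod p) (Polynomial (ZMod p)) :=
    { (A.map ψ).toAddSubgroup with
      smul_mem' := fun c x hx => by
        have : c • x = c.val • x := by
          rw [← Nat.cast_smul_eq_nsmul (ZMod p), ZMod.natCast_zmod_val]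
        rw [this]
        exact (A.map ψ).toAddSubgroup.nsmul_mem hx _ }
  have hB : ∀ {x}, x ∈ B ↔ ∃ y ∈ A, ψ y = x := Iff.rfl
  have haB : ψ a ∉ B := by
    rintro ⟨y, hy, hya⟩
    exact ha (hψ hya ▸ hy)
  obtain ⟨h, hh, hhB⟩ : ∃ h : Polynomial (ZMod p), h.natDegree ≠ 0 ∧ ∀ x ∈ B, h * x ∈ B := by
    by_cases hA : ∀ x ∈ B, x = 0
    · refine ⟨Polynomial.X, by simp, fun x hx => ?_⟩
      rw [hA x hx, mul_zero]
      exact B.zero_mem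
    · push Not at hA
      obtain ⟨h, ⟨y, hy, rfl⟩, h0⟩ := hA
      refine ⟨ψ y, fun hd => h0 ?_, ?_⟩
      · rw [Polynomial.eq_C_of_natDegree_eq_zero hd, hψ0, Polynomial.C_0]
      · rintro _ ⟨z, hz, rfl⟩
        exact ⟨y * z, A.mul_mem hy hz, map_mul ψ y z⟩
  obtain ⟨q, hq, hqB⟩ := Polynomial.exists_ne_zero_forall_sub_mul_notMem hh B hhB haB
  have hfin : Module.Finite (ZMod p) (AdjoinRoot q) := (AdjoinRoot.powerBasis hq).finite
  refine ⟨AdjoinRoot q, inferInstance, Module.finite_of_finite (ZMod p),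
    (AdjoinRoot.mk q).toNonUnitalRingHom.comp ψ, ?_⟩
  rintro ⟨y, hy, hya⟩
  obtain ⟨x, hx⟩ := AdjoinRoot.mk_eq_mk.1 (show AdjoinRoot.mk q (ψ a) = AdjoinRoot.mk q (ψ y)
    from hya.symm)
  exact hqB x (hB.2 ⟨y, hy, by rw [← hx, sub_sub_cancel]⟩)

/-- A multiple of `f` lies in the ideal of the non-unital ring of polynomials without constant
term generated by `f`. -/
theorem mem_span_zeroConstSubring_of_dvd {p : ℕ} {f : MvPolynomial (Fin 2) (ZMod p)}
    (hf : MvPolynomial.constantCoeff f = 0) {g : zeroConstSubring p}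
    (hg : f ∣ (g : MvPolynomial (Fin 2) (ZMod p))) :
    g ∈ TwoSidedIdeal.span {(⟨f, hf⟩ : zeroConstSubring p)} := by
  obtain ⟨c, hc⟩ := hg
  set f' : zeroConstSubring p := ⟨f, hf⟩
  have hmem : f' ∈ TwoSidedIdeal.span {f'} := TwoSidedIdeal.subset_span rfl
  obtain ⟨n, hn⟩ := ZMod.intCast_surjective (MvPolynomial.constantCoeff c)
  let c' : zeroConstSubring p := ⟨c - (n : MvPolynomial (Fin 2) (ZMod p)), by
    rw [mem_zeroConstSubring, map_sub, map_intCast, hn, sub_self]⟩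
  have : g = n • f' + f' * c' := by
    apply Subtype.ext
    change (g : MvPolynomial (Fin 2) (ZMod p)) = n • f + f * (c - n)
    rw [hc, zsmul_eq_mul]
    ring
  rw [this]
  exact add_mem (zsmul_mem hmem n) (TwoSidedIdeal.mul_mem_right _ _ _ hmem)

/-- A ring homomorphism with kernel generated by `f` induces an embedding of
`Z_p⟨a, b ∣ f (a, b) = 0⟩`. -/
theorem exists_injective_relRing {p : ℕ} {f : MvPolynomial (Fin 2) (ZMod p)}
    (hf : MvPolynomial.constantCoeff f = 0) {S : Type*} [CommRing S]
    (e : MvPolynomial (Fin 2) (ZMod p) →+* S) (he : RingHom.ker e = Ideal.span {f}) :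
    ∃ ψ : relRing p f hf →ₙ+* S, Function.Injective ψ ∧
      ∀ x, ∃ g ∈ zeroConstSubring p, ψ x = e g := by
  set I := TwoSidedIdeal.span {(⟨f, hf⟩ : zeroConstSubring p)} with hI
  have hker : ∀ g h : zeroConstSubring p, I.ringCon g h ↔ e g = e h := by
    intro g h
    rw [TwoSidedIdeal.rel_iff, ← sub_eq_zero, ← map_sub, ← RingHom.mem_ker, he]
    constructor
    · intro hgh
      suffices I ≤ TwoSidedIdeal.ker ((e : _ →ₙ+* S).comp
          (NonUnitalSubringClass.subtype (zeroConstSubring p))) by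
        have := this hgh
        rw [TwoSidedIdeal.mem_ker] at this
        rw [← he, RingHom.mem_ker]
        exact this
      rw [hI, TwoSidedIdeal.span_le, Set.singleton_subset_iff, SetLike.mem_coe,
        TwoSidedIdeal.mem_ker]
      change e f = 0
      rw [← RingHom.mem_ker, he]
      exact Ideal.mem_span_singleton_self f
    · intro hgh
      exact mem_span_zeroConstSubring_of_dvd hf (Ideal.mem_span_singleton.1 hgh)
  let ψ : I.ringCon.Quotient →ₙ+* S :=
    { toFun := Quotient.lift (s := I.ringCon.toSetoid) (fun g => e g) fun g h => (hker g h).1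
      map_mul' := by
        rintro ⟨g⟩ ⟨h⟩
        exact map_mul e (g : MvPolynomial (Fin 2) (ZMod p)) h
      map_zero' := map_zero e
      map_add' := by
        rintro ⟨g⟩ ⟨h⟩
        exact map_add e (g : MvPolynomial (Fin 2) (ZMod p)) h }
  refine ⟨ψ, ?_, ?_⟩
  · rintro ⟨g⟩ ⟨h⟩ hgh
    exact Quotient.sound (s := I.ringCon.toSetoid) ((hker g h).2 hgh)
  · rintro ⟨g⟩
    exact ⟨g, g.2, rfl⟩

/-- The curve `x² + y - y² = 0` over `ZMod 2` is parametrized by `x = t + t²`, `y = t²`. -/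
noncomputable def exKParam : MvPolynomial (Fin 2) (ZMod 2) →ₐ[ZMod 2] Polynomial (ZMod 2) :=
  MvPolynomial.aeval ![Polynomial.X + Polynomial.X ^ 2, Polynomial.X ^ 2]

theorem ker_exKParam : RingHom.ker (exKParam : MvPolynomial (Fin 2) (ZMod 2) →+* Polynomial (ZMod 2)) =
    Ideal.span {(MvPolynomial.X 0 ^ 2 + MvPolynomial.X 1 - MvPolynomial.X 1 ^ 2 :
      MvPolynomial (Fin 2) (ZMod 2))} := by
  set f := (MvPolynomial.X 0 ^ 2 + MvPolynomial.X 1 - MvPolynomial.X 1 ^ 2 :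
      MvPolynomial (Fin 2) (ZMod 2)) with hf
  have h2 : (2 : Polynomial (ZMod 2)) = 0 := CharTwo.two_eq_zero
  have h2' : (2 : MvPolynomial (Fin 2) (ZMod 2)) = 0 := CharTwo.two_eq_zero
  apply le_antisymm
  · intro g hg
    let s : Polynomial (ZMod 2) →ₐ[ZMod 2] MvPolynomial (Fin 2) (ZMod 2) :=
      Polynomial.aeval (MvPolynomial.X 0 + MvPolynomial.X 1)
    have hs : (Ideal.Quotient.mkₐ (ZMod 2) (Ideal.span {f})).comp (s.comp exKParam) =
        Ideal.Quotient.mkₐ (ZMod 2) (Ideal.span {f}) := by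
      apply MvPolynomial.algHom_ext
      intro i
      simp only [AlgHom.comp_apply, Ideal.Quotient.mkₐ_eq_mk]
      rw [Ideal.Quotient.eq, Ideal.mem_span_singleton]
      fin_cases i
      · refine ⟨1, ?_⟩
        simp only [exKParam, s, hf, MvPolynomial.aeval_X]
        simp
        linear_combination (MvPolynomial.X 0 * MvPolynomial.X 1 + MvPolynomial.X 1 ^ 2) * h2'
      · refine ⟨1, ?_⟩
        simp only [exKParam, s, hf, MvPolynomial.aeval_X]
        simp
        linear_combination (MvPolynomial.X 0 * MvPolynomial.X 1 + MvPolynomial.X 1 ^ 2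
          - MvPolynomial.X 1) * h2'
    have := DFunLike.congr_fun hs g
    have hg0 : exKParam g = 0 := hg
    rw [AlgHom.comp_apply, AlgHom.comp_apply, hg0, map_zero, map_zero] at this
    exact Ideal.Quotient.eq_zero_iff_mem.1 this.symm
  · rw [Ideal.span_singleton_le_iff_mem, RingHom.mem_ker]
    simp [hf, exKParam]
    linear_combination (Polynomial.X ^ 2 + Polynomial.X ^ 3) * h2

theorem coeff_zero_exKParam (g : MvPolynomial (Fin 2) (ZMod 2)) :
    (exKParam g).coeff 0 = MvPolynomial.constantCoeff g := by
  have : (Polynomial.constantCoeff.comp (exKParam : MvPolynomial (Fin 2) (ZMod 2) →+* Polynomial (ZMod 2))) =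
      MvPolynomial.constantCoeff := by
    apply MvPolynomial.ringHom_ext
    · intro r; simp [exKParam]
    · intro i; fin_cases i <;> simp [exKParam]
  exact DFunLike.congr_fun this g

/-- The ring `K = Z_2⟨a, b ∣ a² + b − b² = 0⟩` is finitely separable. -/
theorem stmt14 : FinitelySeparable (exK 2) := by
  obtain ⟨ψ, hψ, hψ0⟩ := exists_injective_relRing (relPoly_mem 2) _ ker_exKParam
  refine finitelySeparable_of_injective (K := relRing 2 _ (relPoly_mem 2)) ψ hψ fun x => ?_
  obtain ⟨g, hg, hgx⟩ := hψ0 x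
  rw [hgx]
  exact (coeff_zero_exKParam g).trans hg
end

section
/- The polynomial x² + y − y² is irreducible in the polynomial ring Z_2[x, y] and is irreducible in the polynomial ring Z_3[x, y]; consequently, for p ∈ {2, 3} the quotient ring Z_p[x, y]/(x² + y − y²) is a ring without zero divisors. -/
open MvPolynomial in
/-- The conic `x² + y − y²` is irreducible over any field, by Eisenstein's criterion at `y`. -/
theorem irreducible_X_sq_add_X_sub_X_sq (K : Type*) [Field K] :
    Irreducible (X 0 ^ 2 + X 1 - X 1 ^ 2 : MvPolynomial (Fin 2) K) := by
  rw [← MulEquiv.irreducible_iff (finSuccEquiv K 1)]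
  have himage : finSuccEquiv K 1 (X 0 ^ 2 + X 1 - X 1 ^ 2) =
      Polynomial.X ^ 2 + Polynomial.C (X 0 - X 0 ^ 2 : MvPolynomial (Fin 1) K) := by
    rw [show (1 : Fin 2) = Fin.succ 0 from rfl]
    simp only [map_sub, map_add, map_pow, finSuccEquiv_X_zero, finSuccEquiv_X_succ]
    ring
  rw [himage]
  have hmonic := Polynomial.monic_X_pow_add_C (X 0 - X 0 ^ 2 : MvPolynomial (Fin 1) K) two_ne_zero
  have hdegree : (Polynomial.X ^ 2 +
      Polynomial.C (X 0 - X 0 ^ 2 : MvPolynomial (Fin 1) K)).degree = 2 :=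
    Polynomial.degree_X_pow_add_C two_pos _
  have hprime : Prime (X 0 : MvPolynomial (Fin 1) K) := X_prime
  have hmem : (X 0 - X 0 ^ 2 : MvPolynomial (Fin 1) K) ∈ Ideal.span {X 0} :=
    Ideal.mem_span_singleton.2 ⟨1 - X 0, by ring⟩
  refine Polynomial.irreducible_of_eisenstein_criterion
    ((Ideal.span_singleton_prime hprime.ne_zero).2 hprime) ?_ ?_ ?_ ?_ hmonic.isPrimitive
  · rw [hmonic.leadingCoeff]
    exact fun h => hprime.not_dvd_one (Ideal.mem_span_singleton.1 h)
  · intro n hn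
    rw [hdegree] at hn
    have hn : n < 2 := by exact_mod_cast hn
    interval_cases n
    · rw [Polynomial.coeff_add, Polynomial.coeff_C_zero, Polynomial.coeff_X_pow]
      simpa using hmem
    · rw [Polynomial.coeff_add, Polynomial.coeff_C_of_ne_zero one_ne_zero, Polynomial.coeff_X_pow]
      simp
  · rw [hdegree]
    norm_num
  · rw [Ideal.span_singleton_pow, Ideal.mem_span_singleton]
    rintro ⟨q, hq⟩
    simp only [Polynomial.coeff_add, Polynomial.coeff_X_pow, Polynomial.coeff_C_zero] at hq
    refine hprime.not_dvd_one ⟨1 + q, mul_left_cancel₀ hprime.ne_zero ?_⟩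
    norm_num at hq
    linear_combination hq

open MvPolynomial in
/-- The polynomial `x² + y − y²` is irreducible in `Z_2[x, y]` and in
`Z_3[x, y]`; consequently, for `p ∈ {2, 3}` the quotient ring `Z_p[x, y] / (x² + y − y²)` is a
ring without zero divisors. -/
theorem stmt15 :
    Irreducible (X 0 ^ 2 + X 1 - X 1 ^ 2 : MvPolynomial (Fin 2) (ZMod 2)) ∧
    Irreducible (X 0 ^ 2 + X 1 - X 1 ^ 2 : MvPolynomial (Fin 2) (ZMod 3)) ∧
    ∀ p : ℕ, p = 2 ∨ p = 3 →
      ∀ u v : MvPolynomial (Fin 2) (ZMod p) ⧸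
          Ideal.span {(X 0 ^ 2 + X 1 - X 1 ^ 2 : MvPolynomial (Fin 2) (ZMod p))},
        u ≠ 0 → v ≠ 0 → u * v ≠ 0 := by
  have : Fact (Nat.Prime 2) := ⟨Nat.prime_two⟩
  have : Fact (Nat.Prime 3) := ⟨Nat.prime_three⟩
  refine ⟨irreducible_X_sq_add_X_sub_X_sq _, irreducible_X_sq_add_X_sub_X_sq _, ?_⟩
  intro p hp u v hu hv
  have : Fact p.Prime := ⟨by rcases hp with rfl | rfl <;> norm_num⟩
  have hprime := (irreducible_X_sq_add_X_sub_X_sq (ZMod p)).prime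
  have := (Ideal.span_singleton_prime hprime.ne_zero).2 hprime
  exact mul_ne_zero hu hv
end

section
/- Let p be a prime and let f(x, y) ∈ Z_p[x, y] be a homogeneous polynomial of degree n ≥ 1 that is irreducible and monic as a polynomial in x. Then there exist a finite field C_p of characteristic p and an injective (not necessarily unital) ring homomorphism from the ring K = Z_p⟨a, b ∣ f(a, b) = 0⟩ into the polynomial ring C_p[x]; in fact K embeds as the subring generated by λ·x and x for some element λ of C_p. -/
section PlaneCurve

open Polynomial

variable {K : Type*} [Field K]

/-- A bivariate polynomial viewed as a polynomial in the first variable whose coefficients are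
polynomials in the second variable. -/
noncomputable def toIteratedPoly : MvPolynomial (Fin 2) K →ₐ[K] K[X][X] :=
  MvPolynomial.aeval ![X, C X]

lemma toIteratedPoly_monomial (m : Fin 2 →₀ ℕ) (c : K) :
    toIteratedPoly (MvPolynomial.monomial m c) = monomial (m 0) (C c * X ^ m 1) := by
  rw [toIteratedPoly, MvPolynomial.aeval_monomial, Finsupp.prod_fintype _ _ (by simp),
    ← C_mul_X_pow_eq_monomial]
  simp only [Fin.prod_univ_two, Matrix.cons_val_zero, Matrix.cons_val_one, ← C_pow, C_mul]
  rw [show algebraMap K K[X][X] c = C (C c) from rfl]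
  ring

lemma coeff_toIteratedPoly (f : MvPolynomial (Fin 2) K) (k : ℕ) :
    (toIteratedPoly f).coeff k =
      ∑ m ∈ f.support, if m 0 = k then C (f.coeff m) * X ^ m 1 else 0 := by
  conv_lhs => rw [f.as_sum, map_sum, finsetSum_coeff]
  simp only [toIteratedPoly_monomial, coeff_monomial]

/-- A homogeneous polynomial of degree `n` in which `x ^ n` has coefficient `1` is monic of
degree `n` in `x`. -/
lemma monic_toIteratedPoly {f : MvPolynomial (Fin 2) K} {n : ℕ} (hhom : f.IsHomogeneous n)
    (hc : f.coeff (Finsupp.single 0 n) = 1) :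
    (toIteratedPoly f).Monic ∧ (toIteratedPoly f).natDegree = n := by
  have hsum : ∀ m ∈ f.support, m 0 + m 1 = n := fun m hm ↦ by
    have := hhom.degree_eq_sum_deg_support hm
    rw [this, ← Finsupp.degree_apply, Finsupp.degree_eq_sum, Fin.sum_univ_two]
  have hcoeff : (toIteratedPoly f).coeff n = 1 := by
    rw [coeff_toIteratedPoly, Finset.sum_eq_single (Finsupp.single 0 n)]
    · simp [hc]
    · intro m hm hne
      refine if_neg fun h ↦ hne ?_
      have := hsum m hm
      ext i
      fin_cases i
      · simpa using h
      · simp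
        omega
    · intro h
      simp [MvPolynomial.mem_support_iff, hc] at h
  have hle : (toIteratedPoly f).natDegree ≤ n := by
    rw [natDegree_le_iff_coeff_eq_zero]
    intro k hk
    rw [coeff_toIteratedPoly]
    refine Finset.sum_eq_zero fun m hm ↦ if_neg ?_
    have := hsum m hm
    omega
  have hdeg : (toIteratedPoly f).natDegree = n :=
    le_antisymm hle (le_natDegree_of_ne_zero (by simp [hcoeff]))
  exact ⟨by rw [Monic, leadingCoeff, hdeg, hcoeff], hdeg⟩

/-- If `f` is irreducible and monic in `x`, and vanishes at `(λ t, t)`, then it divides every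
polynomial vanishing at `(λ t, t)`. -/
lemma dvd_of_aeval_line_eq_zero {L : Type*} [Field L] [Algebra K L] {lam : L}
    {f h : MvPolynomial (Fin 2) K} (hirr : Irreducible f) (hmon : (toIteratedPoly f).Monic)
    (hf : MvPolynomial.aeval ![C lam * X, (X : L[X])] f = 0)
    (hh : MvPolynomial.aeval ![C lam * X, (X : L[X])] h = 0) : f ∣ h := by
  let I : Ideal (MvPolynomial (Fin 2) K) := Ideal.span {f}
  have hI : I.IsPrime := (Ideal.span_singleton_prime hirr.ne_zero).2 hirr.prime
  let A := MvPolynomial (Fin 2) K ⧸ I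
  let q : MvPolynomial (Fin 2) K →ₐ[K] A := Ideal.Quotient.mkₐ K I
  let ι : K[X] →ₐ[K] A := aeval (q (MvPolynomial.X 1))
  let _ : Algebra K[X] A := ι.toRingHom.toAlgebra
  have hcomp : ∀ g, eval₂ ι.toRingHom (q (MvPolynomial.X 0)) (toIteratedPoly g) = q g := by
    intro g
    induction g using MvPolynomial.induction_on with
    | C a =>
      rw [← MvPolynomial.algebraMap_eq, AlgHom.commutes, AlgHom.commutes,
        show algebraMap K K[X][X] a = C (C a) from rfl, eval₂_C]
      exact aeval_C _ _
    | add a b ha hb => simp only [map_add, eval₂_add, ha, hb]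
    | mul_X a i ha =>
      rw [map_mul, map_mul, eval₂_mul, ha]
      congr 1
      fin_cases i <;> simp [toIteratedPoly, ι]
  have hqf : q f = 0 := Ideal.Quotient.eq_zero_iff_mem.2 (Ideal.mem_span_singleton_self f)
  have hint : Algebra.IsIntegral K[X] A := by
    refine ⟨fun a ↦ ?_⟩
    obtain ⟨g, rfl⟩ := Ideal.Quotient.mk_surjective a
    change IsIntegral K[X] (q g)
    induction g using MvPolynomial.induction_on with
    | C a =>
      rw [← hcomp, ← MvPolynomial.algebraMap_eq, AlgHom.commutes,
        show algebraMap K K[X][X] a = C (C a) from rfl, eval₂_C]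
      exact isIntegral_algebraMap
    | add a b ha hb => rw [map_add]; exact ha.add hb
    | mul_X a i ha =>
      rw [map_mul]
      refine ha.mul ?_
      fin_cases i
      · exact ⟨_, hmon, (hcomp f).trans hqf⟩
      · have : q (MvPolynomial.X 1) = algebraMap K[X] A X := (aeval_X _).symm
        exact this ▸ isIntegral_algebraMap
  let ev : A →ₐ[K] L[X] := Ideal.Quotient.liftₐ I (MvPolynomial.aeval ![C lam * X, X])
    fun a ha ↦ by
      obtain ⟨b, rfl⟩ := Ideal.mem_span_singleton.1 ha
      rw [map_mul, hf, zero_mul]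
  have hker : RingHom.ker ev = ⊥ := by
    refine Ideal.eq_bot_of_comap_eq_bot (R := K[X]) (eq_bot_iff.2 fun r hr ↦ ?_)
    have hcomp' : ev.comp ι = mapAlgHom (Algebra.ofId K L) := by
      refine Polynomial.algHom_ext ?_
      have hev : ∀ g, ev (q g) = MvPolynomial.aeval ![C lam * X, X] g := fun _ ↦ rfl
      simp [ι, hev]
    have h0 : ev (ι r) = 0 := hr
    rw [← AlgHom.comp_apply, hcomp'] at h0
    exact (Polynomial.map_eq_zero _).1 h0
  have hqh : q h ∈ RingHom.ker ev := hh
  rw [hker, Ideal.mem_bot] at hqh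
  exact Ideal.mem_span_singleton.1 (Ideal.Quotient.eq_zero_iff_mem.1 hqh)

/-- A homogeneous polynomial vanishing at `(λ, 1)` vanishes at `(λ t, t)`. -/
lemma aeval_line_eq_zero {L : Type*} [Field L] [Algebra K L] {lam : L} {n : ℕ}
    {f : MvPolynomial (Fin 2) K} (hhom : f.IsHomogeneous n)
    (h : MvPolynomial.aeval ![lam, 1] f = 0) :
    MvPolynomial.aeval ![C lam * X, (X : L[X])] f = 0 := by
  have key : MvPolynomial.aeval ![C lam * X, (X : L[X])] f =
      X ^ n * C (MvPolynomial.aeval ![lam, 1] f) := by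
    rw [MvPolynomial.aeval_def, MvPolynomial.aeval_def, MvPolynomial.eval₂_eq',
      MvPolynomial.eval₂_eq', map_sum, Finset.mul_sum]
    refine Finset.sum_congr rfl fun m hm ↦ ?_
    have := hhom.degree_eq_sum_deg_support hm
    rw [← Finsupp.degree_apply, Finsupp.degree_eq_sum, Fin.sum_univ_two] at this
    rw [this, show algebraMap K L[X] (f.coeff m) = C (algebraMap K L (f.coeff m)) from rfl]
    simp [Fin.prod_univ_two]
    ring
  rw [key, h, C_0, mul_zero]

/-- A homogeneous polynomial of positive degree, monic in `x`, vanishes at `(λ, 1)` for some `λ`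
in the splitting field of `f (x, 1)`. -/
lemma exists_finite_extension_root {f : MvPolynomial (Fin 2) K} {n : ℕ} (hn : n ≠ 0)
    (hmon : (toIteratedPoly f).Monic) (hdeg : (toIteratedPoly f).natDegree = n) :
    ∃ g : K[X], ∃ lam : g.SplittingField, MvPolynomial.aeval ![lam, 1] f = 0 := by
  let g : K[X] := (toIteratedPoly f).map (evalRingHom 1)
  have hg : g.natDegree ≠ 0 := by rwa [hmon.natDegree_map, hdeg]
  obtain ⟨lam, hlam⟩ := (SplittingField.splits g).exists_eval_eq_zero (by
    rw [degree_map]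
    exact fun h ↦ hg (natDegree_eq_zero_iff_degree_le_zero.2 h.le))
  refine ⟨g, lam, ?_⟩
  rw [← hlam, eval_map]
  have hcomp : ∀ e : MvPolynomial (Fin 2) K,
      MvPolynomial.aeval ![lam, 1] e =
        aeval lam (mapAlgHom (aeval (1 : K)) (toIteratedPoly e)) := by
    intro e
    induction e using MvPolynomial.induction_on with
    | C a => simp [← MvPolynomial.algebraMap_eq]
    | add a b ha hb => simp only [map_add, ha, hb]
    | mul_X a i ha =>
      rw [map_mul, map_mul, map_mul, map_mul, ha]
      congr 1
      fin_cases i <;> simp [toIteratedPoly]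
  rw [hcomp]
  rfl

end PlaneCurve

lemma ZMod.val_nsmul_eq_smul {p : ℕ} [NeZero p] {M : Type*} [AddCommGroup M] [Module (ZMod p) M]
    (c : ZMod p) (x : M) : c.val • x = c • x := by
  rw [← Nat.cast_smul_eq_nsmul (ZMod p), ZMod.natCast_zmod_val]

/-- Multiples of `f` lie in the two-sided ideal generated by `f` in the non-unital ring of
polynomials with zero constant term. -/
lemma mem_span_of_dvd {p : ℕ} [Fact p.Prime] {f h : zeroConstSubring p}
    (hdvd : (f : MvPolynomial (Fin 2) (ZMod p)) ∣ h) : h ∈ TwoSidedIdeal.span {f} := by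
  obtain ⟨q, hq⟩ := hdvd
  have hfmem : f ∈ TwoSidedIdeal.span {f} := TwoSidedIdeal.subset_span rfl
  let c := MvPolynomial.constantCoeff q
  let q₀ : zeroConstSubring p := ⟨q - MvPolynomial.C c, by simp [mem_zeroConstSubring, c]⟩
  have : h = c.val • f + f * q₀ := by
    ext1
    change (h : MvPolynomial (Fin 2) (ZMod p)) =
      c.val • (f : MvPolynomial (Fin 2) (ZMod p)) + f.1 * (q - MvPolynomial.C c)
    rw [hq, ZMod.val_nsmul_eq_smul, MvPolynomial.smul_eq_C_mul]
    ring
  rw [this]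
  exact add_mem (nsmul_mem hfmem _) (TwoSidedIdeal.mul_mem_right _ _ _ hfmem)

/-- The evaluation of a bivariate polynomial at `(u, v)` differs from its constant term by an
element of the non-unital subring generated by `u` and `v`. -/
lemma aeval_sub_constantCoeff_mem_closure {p : ℕ} [Fact p.Prime] {S : Type*} [CommRing S]
    [Algebra (ZMod p) S] (u v : S) (h : MvPolynomial (Fin 2) (ZMod p)) :
    MvPolynomial.aeval ![u, v] h - algebraMap _ S (MvPolynomial.constantCoeff h) ∈
      NonUnitalSubring.closure {u, v} := by
  have hvar : ∀ i : Fin 2, ![u, v] i ∈ NonUnitalSubring.closure {u, v} := by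
    intro i
    apply NonUnitalSubring.subset_closure
    fin_cases i <;> simp
  induction h using MvPolynomial.induction_on with
  | C a => simp
  | add a b ha hb =>
    convert add_mem ha hb using 1
    simp only [map_add]
    ring
  | mul_X a i ha =>
    convert add_mem (mul_mem ha (hvar i))
      (nsmul_mem (hvar i) (MvPolynomial.constantCoeff a).val) using 1
    rw [ZMod.val_nsmul_eq_smul, Algebra.smul_def]
    simp only [map_mul, MvPolynomial.constantCoeff_X, map_zero, MvPolynomial.aeval_X]
    ring

/-- A homomorphism on the polynomials with zero constant term that kills exactly the ideal
generated by `f` induces an injective homomorphism on `relRing p f hf` with the same range. -/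
lemma exists_injective_hom_of_ker_eq_span {p : ℕ} {f : MvPolynomial (Fin 2) (ZMod p)}
    (hf : MvPolynomial.constantCoeff f = 0) {S : Type*} [NonUnitalRing S]
    (ψ : zeroConstSubring p →ₙ+* S)
    (hker : ∀ h, ψ h = 0 ↔ h ∈ TwoSidedIdeal.span {(⟨f, hf⟩ : zeroConstSubring p)}) :
    ∃ φ : relRing p f hf →ₙ+* S, Function.Injective φ ∧ Set.range φ = Set.range ψ := by
  let I := TwoSidedIdeal.span {(⟨f, hf⟩ : zeroConstSubring p)}
  have hrel : ∀ a b, I.ringCon a b ↔ ψ a = ψ b := fun a b ↦ by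
    rw [TwoSidedIdeal.rel_iff, ← hker, map_sub, sub_eq_zero]
  let φ : I.ringCon.Quotient →ₙ+* S :=
    { toFun := Quot.lift ψ fun a b hab ↦ (hrel a b).1 hab
      map_mul' := by rintro ⟨a⟩ ⟨b⟩; exact map_mul ψ a b
      map_zero' := map_zero ψ
      map_add' := by rintro ⟨a⟩ ⟨b⟩; exact map_add ψ a b }
  refine ⟨φ, ?_, ?_⟩
  · rintro ⟨a⟩ ⟨b⟩ hab
    exact Quot.sound ((hrel a b).2 hab)
  · exact Set.range_quot_lift _

/-- Let `p` be a prime and `f ∈ Z_p[x, y]` a homogeneous polynomial of degree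
`n ≥ 1` that is irreducible and monic as a polynomial in `x`. Then there are a finite field
`C_p` of characteristic `p` and an injective (not necessarily unital) ring homomorphism from
`K = Z_p⟨a, b ∣ f (a, b) = 0⟩` into the polynomial ring `C_p[x]`; in fact `K` embeds as the
subring generated by `λ • x` and `x` for some `λ ∈ C_p`. -/
theorem stmt17 (p : ℕ) (hp : p.Prime) (n : ℕ) (hn : 1 ≤ n)
    (f : MvPolynomial (Fin 2) (ZMod p)) (hhom : f.IsHomogeneous n)
    (hirr : Irreducible f) (hmonic : MonicInVar f 0)
    (hf : MvPolynomial.constantCoeff f = 0) :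
    ∃ (Cp : Type) (_ : Field Cp) (_ : Finite Cp) (_ : CharP Cp p)
      (φ : relRing p f hf →ₙ+* Polynomial Cp),
      Function.Injective φ ∧
      ∃ lam : Cp,
        Set.range φ =
          (NonUnitalSubring.closure
            {Polynomial.C lam * Polynomial.X, Polynomial.X} : Set (Polynomial Cp)) := by
  have : Fact p.Prime := ⟨hp⟩
  have hdeg : f.degreeOf 0 = n := by
    have := hhom (d := Finsupp.single 0 (f.degreeOf 0)) (by rw [hmonic.1]; exact one_ne_zero)
    simpa [Finsupp.weight_apply] using this
  obtain ⟨hmon, hnat⟩ := monic_toIteratedPoly hhom (hdeg ▸ hmonic.1)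
  obtain ⟨g, lam, hlam⟩ := exists_finite_extension_root (by omega) hmon hnat
  have hline := aeval_line_eq_zero hhom hlam
  let ev := MvPolynomial.aeval (R := ZMod p)
    ![Polynomial.C lam * Polynomial.X, (Polynomial.X : Polynomial g.SplittingField)]
  let ψ : zeroConstSubring p →ₙ+* Polynomial g.SplittingField :=
    (ev : _ →ₙ+* Polynomial g.SplittingField).comp (NonUnitalSubringClass.subtype _)
  have hker : ∀ h, ψ h = 0 ↔ h ∈ TwoSidedIdeal.span {(⟨f, hf⟩ : zeroConstSubring p)} := by
    refine fun h ↦ ⟨fun h0 ↦ mem_span_of_dvd (dvd_of_aeval_line_eq_zero hirr hmon hline h0), ?_⟩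
    rw [← TwoSidedIdeal.mem_ker]
    refine fun hh ↦ TwoSidedIdeal.span_le.2 ?_ hh
    rintro _ rfl
    exact (TwoSidedIdeal.mem_ker ψ).2 hline
  obtain ⟨φ, hinj, hrange⟩ := exists_injective_hom_of_ker_eq_span hf ψ hker
  refine ⟨g.SplittingField, inferInstance, Module.finite_of_finite (ZMod p), inferInstance, φ,
    hinj, lam, ?_⟩
  rw [hrange]
  refine Set.Subset.antisymm ?_ ?_
  · rintro _ ⟨h, rfl⟩
    have := aeval_sub_constantCoeff_mem_closure (Polynomial.C lam * Polynomial.X)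
      (Polynomial.X : Polynomial g.SplittingField) h.1
    rwa [(mem_zeroConstSubring p h.1).1 h.2, map_zero, sub_zero] at this
  · rw [← NonUnitalRingHom.coe_range, SetLike.coe_subset_coe, NonUnitalSubring.closure_le]
    rintro _ (rfl | rfl)
    · exact ⟨⟨MvPolynomial.X 0, by simp [mem_zeroConstSubring]⟩, MvPolynomial.aeval_X _ 0⟩
    · exact ⟨⟨MvPolynomial.X 1, by simp [mem_zeroConstSubring]⟩, MvPolynomial.aeval_X _ 1⟩
end
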